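/- arXiv:2402.00511 — 3 statements merged into one kernel-verified Lean document; each statement's English description precedes it below -/
import Mathlib

section
/- Let X be a Banach two-sided ℍ-module, let D(A) be a right ℍ-submodule of X, and let A : D(A) → X be a closed right linear operator such that ρ_S(A) ∩ ℝ ≠ ∅. Let q0 ∈ ℍ and let (p_n)_{n∈ℕ} be a sequence in ρ_S(A) converging to q0 with respect to the Cassini topology of ℍ. Then q0 ∈ σ_S(A) if and only if lim_{n→∞} ‖Q_{p_n}(A)‖ = ∞. -/
open MulOpposite Filter Topology Classical

noncomputable section

notation "ℍ" => Quaternion ℝ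

/-- A *Banach two-sided `ℍ`-module*: a two-sided `ℍ`-module (left `ℍ`-action, right
`ℍ`-action encoded as a left `ℍᵐᵒᵖ`-action) whose complete norm satisfies
`‖qx‖ = ‖xq‖ = |q|‖x‖`, and where real scalars act the same on both sides. -/
class QuatBimodule (Y : Type*) [NormedAddCommGroup Y]
    [Module ℍ Y] [Module ℍᵐᵒᵖ Y] : Prop where
  smul_op_comm : ∀ (p q : ℍ) (y : Y), p • (op q • y) = op q • (p • y)
  norm_smul_left : ∀ (q : ℍ) (y : Y), ‖q • y‖ = ‖q‖ * ‖y‖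
  norm_smul_right : ∀ (q : ℍ) (y : Y), ‖op q • y‖ = ‖q‖ * ‖y‖
  real_smul_comm : ∀ (r : ℝ) (y : Y), ((r : ℝ) : ℍ) • y = op ((r : ℝ) : ℍ) • y

variable {X : Type*} [NormedAddCommGroup X] [Module ℍ X] [Module ℍᵐᵒᵖ X]

/-- Membership in `Lin^r(X)`: additive, right `ℍ`-linear, with finite operator
norm (i.e. `‖B x‖` is bounded on the closed unit ball). -/
def MemLinR (B : X → X) : Prop :=
  (∀ x y : X, B (x + y) = B x + B y) ∧
  (∀ (q : ℍ) (x : X), B (op q • x) = op q • B x) ∧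
  BddAbove ((fun x : X => ‖B x‖) '' {x : X | ‖x‖ ≤ 1})

/-- The operator norm `‖B‖ = sup {‖B x‖ : ‖x‖ ≤ 1}`. -/
def opNorm (B : X → X) : ℝ :=
  sSup ((fun x : X => ‖B x‖) '' {x : X | ‖x‖ ≤ 1})

/-- A right linear operator `A : D(A) → X`, where `D(A)` is a right `ℍ`-submodule
of `X`.  It is encoded as a function `X → X` together with its domain; only the
values on the domain are relevant. -/
structure RightLinearOp (X : Type*) [NormedAddCommGroup X]
    [Module ℍ X] [Module ℍᵐᵒᵖ X] where
  dom : Set X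
  toFun : X → X
  zero_mem : (0 : X) ∈ dom
  add_mem : ∀ ⦃x⦄, x ∈ dom → ∀ ⦃y⦄, y ∈ dom → x + y ∈ dom
  neg_mem : ∀ ⦃x⦄, x ∈ dom → -x ∈ dom
  smulR_mem : ∀ (q : ℍ) ⦃x⦄, x ∈ dom → op q • x ∈ dom
  map_add' : ∀ ⦃x⦄, x ∈ dom → ∀ ⦃y⦄, y ∈ dom → toFun (x + y) = toFun x + toFun y
  map_smulR' : ∀ (q : ℍ) ⦃x⦄, x ∈ dom → toFun (op q • x) = op q • toFun x

namespace RightLinearOp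

variable (T : RightLinearOp X)

/-- `A` is closed: its graph is closed in `X × X`. -/
def IsClosedOp : Prop := IsClosed {p : X × X | p.1 ∈ T.dom ∧ T.toFun p.1 = p.2}

/-- The domain `D(A²)` of `A²`. -/
def dom2 : Set X := {x | x ∈ T.dom ∧ T.toFun x ∈ T.dom}

/-- The operator `Δ_q(A) = A² − 2 Re(q) A + |q|² Id`, with domain `D(A²)`. -/
def delta (q : ℍ) (x : X) : X :=
  T.toFun (T.toFun x) - ((2 * q.re : ℝ) : ℍ) • T.toFun x + ((‖q‖ ^ 2 : ℝ) : ℍ) • x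

/-- `B` is the inverse of `Δ_q(A) : D(A²) → X`, and `B ∈ Lin^r(X)`. -/
def IsQInv (q : ℍ) (B : X → X) : Prop :=
  MemLinR B ∧ (∀ x : X, B x ∈ T.dom2) ∧ (∀ x : X, T.delta q (B x) = x) ∧
    ∀ x ∈ T.dom2, B (T.delta q x) = x

/-- The S-resolvent set `ρ_S(A)`. -/
def rhoS : Set ℍ := {q | ∃ B : X → X, T.IsQInv q B}

/-- `Q_q(A) = Δ_q(A)⁻¹ ∈ Lin^r(X)`, for `q ∈ ρ_S(A)` (junk value otherwise). -/
def qres (q : ℍ) : X → X :=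
  if h : q ∈ T.rhoS then h.choose else fun _ => 0

/-- The (left) S-resolvent operator `S_q⁻¹(A) = Q_q(A) q̄ − A Q_q(A)`, where the
right scalar multiple of an operator is `(B q̄)(x) = B(q̄ x)`. -/
def sres (q : ℍ) : X → X :=
  fun x => T.qres q (star q • x) - T.toFun (T.qres q x)

/-- The coefficients `B_n`: `B_{2k} = Q_{q0}(A)^k`, `B_{2k+1} = Q_{q0}(A)^k S_{q0}⁻¹(A)`. -/
def Bop (q0 : ℍ) (n : ℕ) : X → X :=
  if n % 2 = 0 then (T.qres q0)^[n / 2] else (T.qres q0)^[n / 2] ∘ T.sres q0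

end RightLinearOp

/-- The quaternionic polynomial `Δ_q(p) = p² − 2 Re(q) p + |q|²`. -/
def deltaPoly (q p : ℍ) : ℍ :=
  p ^ 2 - ((2 * q.re : ℝ) : ℍ) * p + ((‖q‖ ^ 2 : ℝ) : ℍ)

/-- The "powers" `p_{q0,n}`: `p_{q0,2k}(q) = Δ_{q0}(q)^k`,
`p_{q0,2k+1}(q) = (q − q0) Δ_{q0}(q)^k`. -/
def spow (q0 : ℍ) (n : ℕ) (q : ℍ) : ℍ :=
  if n % 2 = 0 then deltaPoly q0 q ^ (n / 2) else (q - q0) * deltaPoly q0 q ^ (n / 2)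

/-- The Cassini pseudo-metric `u(p,q) = √|Δ_q(p)|`. -/
def cassini (p q : ℍ) : ℝ := Real.sqrt ‖deltaPoly q p‖

/-- The Cassini ball `U(q0,R)`. -/
def cassiniBall (q0 : ℍ) (R : ℝ) : Set ℍ := {p : ℍ | cassini p q0 < R}

/-- The Cassini topology on `ℍ`: the topology induced by the Cassini pseudo-metric,
i.e. the topology generated by the Cassini balls. -/
def cassiniTopology : TopologicalSpace ℍ :=
  TopologicalSpace.generateFrom {U : Set ℍ | ∃ q0 R, 0 < R ∧ U = cassiniBall q0 R}

/-- The spherical derivative of a function `g : ℍ → ℍ`. -/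
def sderivQ (g : ℍ → ℍ) (q : ℍ) : ℍ :=
  if q.im = 0 then deriv (fun t : ℝ => g ((t : ℝ) : ℍ)) q.re
  else (g q - g (star q)) * (q - star q)⁻¹

end

lemma Quaternion.norm_sq_eq (a : ℍ) :
    ‖a‖ ^ 2 = a.re ^ 2 + a.imI ^ 2 + a.imJ ^ 2 + a.imK ^ 2 := by
  rw [sq, ← Quaternion.normSq_eq_norm_mul_self, Quaternion.normSq_def']

lemma Quaternion.norm_sq_eq_re_sq_add_norm_im_sq (a : ℍ) : ‖a‖ ^ 2 = a.re ^ 2 + ‖a.im‖ ^ 2 := by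
  rw [Quaternion.norm_sq_eq, Quaternion.norm_sq_eq a.im]
  simp only [Quaternion.re_im, Quaternion.imI_im, Quaternion.imJ_im, Quaternion.imK_im]
  ring

lemma sq_sub_add_sq_sub_le_norm_deltaPoly (p q : ℍ) :
    (p.re - q.re) ^ 2 + (‖p.im‖ - ‖q.im‖) ^ 2 ≤ ‖deltaPoly q p‖ := by
  have key : ‖deltaPoly q p‖ ^ 2 = ((p.re - q.re) ^ 2 + (‖p.im‖ - ‖q.im‖) ^ 2) *
      ((p.re - q.re) ^ 2 + (‖p.im‖ + ‖q.im‖) ^ 2) := by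
    have h₁ : ‖deltaPoly q p‖ ^ 2 = (p.re ^ 2 - ‖p.im‖ ^ 2 - 2 * q.re * p.re + ‖q‖ ^ 2) ^ 2 +
        (2 * p.re - 2 * q.re) ^ 2 * ‖p.im‖ ^ 2 := by
      rw [Quaternion.norm_sq_eq (deltaPoly q p), Quaternion.norm_sq_eq p.im, deltaPoly, sq p]
      simp only [Quaternion.re_add, Quaternion.re_sub, Quaternion.re_mul, Quaternion.re_coe,
        Quaternion.imI_add, Quaternion.imI_sub, Quaternion.imI_mul, Quaternion.imI_coe,
        Quaternion.imJ_add, Quaternion.imJ_sub, Quaternion.imJ_mul, Quaternion.imJ_coe,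
        Quaternion.imK_add, Quaternion.imK_sub, Quaternion.imK_mul, Quaternion.imK_coe,
        Quaternion.re_im, Quaternion.imI_im, Quaternion.imJ_im, Quaternion.imK_im]
      ring
    rw [h₁, Quaternion.norm_sq_eq_re_sq_add_norm_im_sq q]
    ring
  refine le_of_sq_le_sq ?_ (norm_nonneg _)
  rw [key, sq]
  have := mul_nonneg (norm_nonneg p.im) (norm_nonneg q.im)
  gcongr ?_ * ?_
  nlinarith

lemma tendsto_norm_deltaPoly_of_tendsto_cassini {q0 : ℍ} {p : ℕ → ℍ}
    (hp : Tendsto p atTop (@nhds ℍ cassiniTopology q0)) :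
    Tendsto (fun n => ‖deltaPoly q0 (p n)‖) atTop (𝓝 0) := by
  have hself : deltaPoly q0 q0 = 0 := by
    rw [deltaPoly, Quaternion.norm_sq_eq, sq q0]
    ext <;>
      simp only [Quaternion.re_add, Quaternion.re_sub, Quaternion.re_mul, Quaternion.re_coe,
        Quaternion.imI_add, Quaternion.imI_sub, Quaternion.imI_mul, Quaternion.imI_coe,
        Quaternion.imJ_add, Quaternion.imJ_sub, Quaternion.imJ_mul, Quaternion.imJ_coe,
        Quaternion.imK_add, Quaternion.imK_sub, Quaternion.imK_mul, Quaternion.imK_coe,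
        Quaternion.re_zero, Quaternion.imI_zero, Quaternion.imJ_zero, Quaternion.imK_zero] <;>
      ring
  have hsqrt : Tendsto (fun n => cassini (p n) q0) atTop (𝓝 0) := by
    refine Metric.tendsto_nhds.2 fun ε hε => ?_
    have hopen : @IsOpen ℍ cassiniTopology (cassiniBall q0 ε) :=
      TopologicalSpace.isOpen_generateFrom_of_mem ⟨q0, ε, hε, rfl⟩
    have hmem : q0 ∈ cassiniBall q0 ε := by
      simpa [cassiniBall, cassini, hself] using hε
    filter_upwards [hp (@IsOpen.mem_nhds ℍ cassiniTopology q0 _ hopen hmem)] with n hn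
    rwa [Real.dist_0_eq_abs, cassini, abs_of_nonneg (Real.sqrt_nonneg _)]
  simpa [cassini, Real.sq_sqrt] using hsqrt.pow 2

lemma tendsto_re_and_norm_sq_of_tendsto_cassini {q0 : ℍ} {p : ℕ → ℍ}
    (hp : Tendsto p atTop (@nhds ℍ cassiniTopology q0)) :
    Tendsto (fun n => (p n).re) atTop (𝓝 q0.re) ∧
      Tendsto (fun n => ‖p n‖ ^ 2) atTop (𝓝 (‖q0‖ ^ 2)) := by
  have h0 := tendsto_norm_deltaPoly_of_tendsto_cassini hp
  have hsq {u : ℕ → ℝ} {l : ℝ} (hu : ∀ n, (u n - l) ^ 2 ≤ ‖deltaPoly q0 (p n)‖) :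
      Tendsto u atTop (𝓝 l) := by
    have h₁ : Tendsto (fun n => (u n - l) ^ 2) atTop (𝓝 0) :=
      squeeze_zero (fun n => sq_nonneg _) hu h0
    have h₂ := h₁.sqrt
    simp only [Real.sqrt_sq_eq_abs, Real.sqrt_zero] at h₂
    exact tendsto_sub_nhds_zero_iff.1 ((tendsto_zero_iff_abs_tendsto_zero _).2 h₂)
  have hre : Tendsto (fun n => (p n).re) atTop (𝓝 q0.re) := hsq fun n => by
    linarith [sq_sub_add_sq_sub_le_norm_deltaPoly (p n) q0, sq_nonneg (‖(p n).im‖ - ‖q0.im‖)]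
  have him : Tendsto (fun n => ‖(p n).im‖) atTop (𝓝 ‖q0.im‖) := hsq fun n => by
    linarith [sq_sub_add_sq_sub_le_norm_deltaPoly (p n) q0, sq_nonneg ((p n).re - q0.re)]
  refine ⟨hre, ?_⟩
  rw [Quaternion.norm_sq_eq_re_sq_add_norm_im_sq q0]
  exact ((hre.pow 2).add (him.pow 2)).congr fun n =>
    (Quaternion.norm_sq_eq_re_sq_add_norm_im_sq (p n)).symm

namespace RightLinearOp

variable {X : Type*} [NormedAddCommGroup X] [Module ℍ X] [Module ℍᵐᵒᵖ X] {T : RightLinearOp X}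

lemma sub_mem {x y : X} (hx : x ∈ T.dom) (hy : y ∈ T.dom) : x - y ∈ T.dom := by
  rw [sub_eq_add_neg]
  exact T.add_mem hx (T.neg_mem hy)

lemma map_sub_of_mem {x y : X} (hx : x ∈ T.dom) (hy : y ∈ T.dom) :
    T.toFun (x - y) = T.toFun x - T.toFun y := by
  rw [eq_sub_iff_add_eq, ← T.map_add' (sub_mem hx hy) hy, sub_add_cancel]

lemma IsQInv.eq {q : ℍ} {B B' : X → X} (h : T.IsQInv q B) (h' : T.IsQInv q B') : B = B' := by
  funext x
  rw [← h.2.2.2 _ (h'.2.1 x), h'.2.2.1]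

lemma isQInv_qres {q : ℍ} (hq : q ∈ T.rhoS) : T.IsQInv q (T.qres q) := by
  rw [qres, dif_pos hq]
  exact hq.choose_spec

end RightLinearOp

/-- The real normed space underlying a Banach two-sided `ℍ`-module. -/
noncomputable abbrev QuatBimodule.realNormedSpace (X : Type*) [NormedAddCommGroup X] [Module ℍ X]
    [Module ℍᵐᵒᵖ X] [QuatBimodule X] : NormedSpace ℝ X :=
  { Module.compHom X (algebraMap ℝ ℍ) with
    norm_smul_le := fun r x => by
      change ‖(r : ℍ) • x‖ ≤ _
      rw [QuatBimodule.norm_smul_left, Quaternion.norm_coe] }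

section RealStructure

variable {X : Type*} [NormedAddCommGroup X] [NormedSpace ℝ X]

lemma opNorm_coe (Q : X →L[ℝ] X) : opNorm Q = ‖Q‖ := by
  rw [← Q.sSup_unitClosedBall_eq_norm, opNorm]
  congr 2
  ext x
  simp

lemma coe_quaternion_smul [Module ℍ X] [IsScalarTower ℝ ℍ X] (r : ℝ) (x : X) : (r : ℍ) • x = r • x := by
  rw [← algebraMap_smul ℍ r x]
  rfl

variable [Module ℍᵐᵒᵖ X]

lemma memLinR_coe {Q : X →L[ℝ] X} (hQ : ∀ (q : ℍ) (x : X), Q (op q • x) = op q • Q x) :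
    MemLinR Q := by
  refine ⟨map_add Q, hQ, ‖Q‖, ?_⟩
  rintro _ ⟨x, hx, rfl⟩
  simpa using Q.le_of_opNorm_le_of_le le_rfl hx

namespace RightLinearOp

variable [Module ℍ X] [IsScalarTower ℝ ℍ X] {T : RightLinearOp X}

lemma delta_eq (q : ℍ) (x : X) :
    T.delta q x = T.toFun (T.toFun x) - (2 * q.re) • T.toFun x + ‖q‖ ^ 2 • x := by
  simp only [delta, coe_quaternion_smul]

lemma IsQInv.toFun_apply_eq {r : ℝ} {R : X →L[ℝ] X}
    (hR : ∀ x ∈ T.dom, R (T.toFun x - r • x) = x) {p : ℍ} {Q : X →L[ℝ] X} (hQ : T.IsQInv p Q)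
    (y : X) :
    T.toFun (Q y) = ((2 * p.re - r) • Q + R -
      (r ^ 2 - 2 * p.re * r + ‖p‖ ^ 2) • (R.comp Q)) y := by
  obtain ⟨-, hdom, hright, -⟩ := hQ
  have h₁ := hR _ (hdom y).1
  have h₂ := hR _ (hdom y).2
  have h₃ := hright y
  rw [delta_eq] at h₃
  simp only [map_sub, map_smul] at h₁ h₂
  simp only [sub_apply, add_apply,
    smul_apply, ContinuousLinearMap.comp_apply]
  have h₄ : R y = R (T.toFun (T.toFun (Q y))) - (2 * p.re) • R (T.toFun (Q y)) +
      ‖p‖ ^ 2 • R (Q y) := by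
    rw [← map_smul, ← map_smul, ← map_sub, ← map_add, h₃]
  rw [h₄, sub_eq_iff_eq_add.1 h₂, sub_eq_iff_eq_add.1 h₁]
  module

end RightLinearOp

variable [IsScalarTower ℝ ℍᵐᵒᵖ X]

lemma op_coe_quaternion_smul (r : ℝ) (x : X) : op (r : ℍ) • x = r • x := by
  rw [← algebraMap_smul ℍᵐᵒᵖ r x]
  rfl

lemma MemLinR.exists_continuousLinearMap {B : X → X} (hB : MemLinR B) :
    ∃ Q : X →L[ℝ] X, ⇑Q = B := by
  obtain ⟨hadd, hsmul, C, hC⟩ := hB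
  let L : X →ₗ[ℝ] X :=
    { toFun := B
      map_add' := hadd
      map_smul' := fun r x => by
        simpa only [op_coe_quaternion_smul, RingHom.id_apply] using hsmul r x }
  refine ⟨L.mkContinuousOfExistsBound ⟨C, fun x => ?_⟩, rfl⟩
  rcases eq_or_ne x 0 with rfl | hx
  · simp
  have hx' : ‖x‖ ≠ 0 := norm_ne_zero_iff.2 hx
  have h : ‖L (‖x‖⁻¹ • x)‖ ≤ C :=
    hC ⟨‖x‖⁻¹ • x, by simp [norm_smul, hx'], rfl⟩
  rw [map_smul, norm_smul, norm_inv, norm_norm] at h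
  rwa [inv_mul_le_iff₀ (by positivity), mul_comm] at h

namespace RightLinearOp

variable [Module ℍ X] {T : RightLinearOp X}

lemma map_smul_real (r : ℝ) {x : X} (hx : x ∈ T.dom) : T.toFun (r • x) = r • T.toFun x := by
  simpa only [op_coe_quaternion_smul] using T.map_smulR' (r : ℍ) hx

lemma smul_real_mem (r : ℝ) {x : X} (hx : x ∈ T.dom) : r • x ∈ T.dom := by
  simpa only [op_coe_quaternion_smul] using T.smulR_mem (r : ℍ) hx

variable [IsScalarTower ℝ ℍ X]

lemma exists_resolvent [CompleteSpace X] (hT : T.IsClosedOp) {r : ℝ}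
    (hr : (r : ℍ) ∈ T.rhoS) :
    ∃ R : X →L[ℝ] X, ∀ x ∈ T.dom, R (T.toFun x - r • x) = x := by
  obtain ⟨B, hB⟩ := hr
  obtain ⟨Q, rfl⟩ := hB.1.exists_continuousLinearMap
  obtain ⟨-, hdom, hright, hleft⟩ := hB
  have hdelta (x : X) :
      T.delta (r : ℍ) x = T.toFun (T.toFun x) - (2 * r) • T.toFun x + r ^ 2 • x := by
    rw [delta_eq, Quaternion.re_coe, Quaternion.norm_coe, Real.norm_eq_abs, sq_abs]
  let R : X →ₗ[ℝ] X :=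
    { toFun := fun y => T.toFun (Q y) - r • Q y
      map_add' := fun x y => by
        rw [map_add, T.map_add' (hdom x).1 (hdom y).1]
        module
      map_smul' := fun c x => by
        rw [map_smul, map_smul_real c (hdom x).1, RingHom.id_apply]
        module }
  have hRdom (y : X) : R y ∈ T.dom := sub_mem (hdom y).2 (smul_real_mem r (hdom y).1)
  have hRright (y : X) : T.toFun (R y) - r • R y = y := by
    change T.toFun (T.toFun (Q y) - r • Q y) - r • (T.toFun (Q y) - r • Q y) = y
    rw [map_sub_of_mem (hdom y).2 (smul_real_mem r (hdom y).1), map_smul_real r (hdom y).1]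
    nth_rewrite 5 [← hright y]
    rw [hdelta]
    module
  have hRleft (x : X) (hx : x ∈ T.dom) : R (T.toFun x - r • x) = x := by
    set y := T.toFun x - r • x with hy
    have hv : R y - x ∈ T.dom := sub_mem (hRdom y) hx
    have hTv : T.toFun (R y - x) = r • (R y - x) := by
      rw [map_sub_of_mem (hRdom y) hx, sub_eq_iff_eq_add.1 (hRright y), hy]
      module
    have hv2 : R y - x ∈ T.dom2 := ⟨hv, hTv ▸ smul_real_mem r hv⟩
    have h0 : T.delta (r : ℍ) (R y - x) = 0 := by
      rw [hdelta, hTv, map_smul_real r hv, hTv]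
      module
    have := hleft _ hv2
    rw [h0, map_zero] at this
    exact (sub_eq_zero.1 this.symm)
  refine ⟨⟨R, R.continuous_of_isClosed_graph ?_⟩, hRleft⟩
  have hgraph : (R.graph : Set (X × X)) = (fun z : X × X => (z.2, z.1 + r • z.2)) ⁻¹'
      {z : X × X | z.1 ∈ T.dom ∧ T.toFun z.1 = z.2} := by
    ext ⟨y, x⟩
    simp only [SetLike.mem_coe, LinearMap.mem_graph_iff, Set.mem_preimage, Set.mem_ofPred_eq]
    constructor
    · rintro rfl
      exact ⟨hRdom y, sub_eq_iff_eq_add.1 (hRright y)⟩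
    · rintro ⟨hx, h⟩
      rw [← hRleft x hx, h, add_sub_cancel_right]
  rw [hgraph]
  exact IsClosed.preimage (by fun_prop) hT

lemma IsQInv.exists_of_norm_le_half [CompleteSpace X] {p q : ℍ} {Q P : X →L[ℝ] X}
    (hQ : T.IsQInv p Q) (hP : ∀ y, T.toFun (Q y) = P y)
    (hE : ‖(2 * (q.re - p.re)) • P - (‖q‖ ^ 2 - ‖p‖ ^ 2) • Q‖ ≤ 1 / 2) :
    ∃ Q' : X →L[ℝ] X, T.IsQInv q Q' ∧ ‖Q'‖ ≤ 2 * ‖Q‖ := by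
  set E := (2 * (q.re - p.re)) • P - (‖q‖ ^ 2 - ‖p‖ ^ 2) • Q with hE_def
  obtain ⟨⟨-, hlin, -⟩, hdom, hright, hleft⟩ := hQ
  have hdelta (y : X) : T.delta q (Q y) = (1 - E) y := by
    have h := hright y
    rw [delta_eq, sub_add, sub_eq_iff_eq_add] at h
    simp only [delta_eq, hE_def, sub_apply, smul_apply,
      one_apply_eq_self, ← hP]
    rw [h]
    module
  have hElin (a : ℍ) (x : X) : (1 - E) (op a • x) = op a • (1 - E) x := by
    rw [← hdelta, ← hdelta, hlin]
    have h₁ := T.map_smulR' a (hdom x).1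
    simp only [delta_eq, h₁, T.map_smulR' a (hdom x).2, smul_add, smul_sub, smul_comm _ (op a)]
  let U : (X →L[ℝ] X)ˣ := Units.oneSub E (hE.trans_lt (by norm_num))
  let S : X →L[ℝ] X := ↑U⁻¹
  have hSr : (1 - E) * S = 1 := U.mul_inv
  have hSl : S * (1 - E) = 1 := U.inv_mul
  have hSr' (x : X) : (1 - E) (S x) = x := DFunLike.congr_fun hSr x
  have hSl' (x : X) : S ((1 - E) x) = x := DFunLike.congr_fun hSl x
  have hSnorm : ‖S‖ ≤ 2 := by
    have h₁ : S = 1 + E * S := by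
      rw [← hSr]
      noncomm_ring
    have h₂ : ‖S‖ ≤ 1 + 1 / 2 * ‖S‖ := by
      calc ‖S‖ = ‖1 + E * S‖ := by rw [← h₁]
        _ ≤ ‖(1 : X →L[ℝ] X)‖ + ‖E * S‖ := norm_add_le _ _
        _ ≤ 1 + ‖E‖ * ‖S‖ := add_le_add ContinuousLinearMap.norm_id_le (norm_mul_le _ _)
        _ ≤ 1 + 1 / 2 * ‖S‖ := by gcongr
    linarith
  refine ⟨Q.comp S, ⟨memLinR_coe fun a x => ?_, fun x => hdom (S x), fun x => ?_,
    fun x hx => ?_⟩, ?_⟩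
  · rw [ContinuousLinearMap.comp_apply, ContinuousLinearMap.comp_apply, ← hlin]
    congr 1
    rw [← hSl' (op a • S x), hElin, hSr']
  · rw [ContinuousLinearMap.comp_apply, hdelta, hSr']
  · rw [ContinuousLinearMap.comp_apply]
    nth_rewrite 1 [← hleft x hx]
    rw [hdelta, hSl', hleft x hx]
  · calc ‖Q.comp S‖ ≤ ‖Q‖ * ‖S‖ := Q.opNorm_comp_le S
      _ ≤ ‖Q‖ * 2 := by gcongr
      _ = 2 * ‖Q‖ := mul_comm _ _

lemma IsQInv.exists_of_bound_le_half [CompleteSpace X] {r : ℝ} {R : X →L[ℝ] X}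
    (hR : ∀ x ∈ T.dom, R (T.toFun x - r • x) = x) {p q : ℍ} {Q : X →L[ℝ] X} (hQ : T.IsQInv p Q)
    {M : ℝ} (hM : ‖Q‖ ≤ M)
    (h : |2 * (q.re - p.re)| *
      (|2 * p.re - r| * M + ‖R‖ + |r ^ 2 - 2 * p.re * r + ‖p‖ ^ 2| * (‖R‖ * M)) +
        |‖q‖ ^ 2 - ‖p‖ ^ 2| * M ≤ 1 / 2) :
    ∃ Q' : X →L[ℝ] X, T.IsQInv q Q' ∧ ‖Q'‖ ≤ 2 * ‖Q‖ := by
  refine hQ.exists_of_norm_le_half (hQ.toFun_apply_eq hR) (le_trans ?_ h)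
  refine (norm_sub_le _ _).trans ?_
  rw [norm_smul, norm_smul, Real.norm_eq_abs, Real.norm_eq_abs]
  gcongr
  refine (norm_sub_le _ _).trans (add_le_add ((norm_add_le _ _).trans ?_) ?_)
  · rw [norm_smul, Real.norm_eq_abs]
    gcongr
  · rw [norm_smul, Real.norm_eq_abs]
    gcongr
    exact (R.opNorm_comp_le Q).trans (by gcongr)

theorem notMem_rhoS_iff_tendsto_opNorm_qres [CompleteSpace X] (hT : T.IsClosedOp)
    (hreal : ∃ r : ℝ, (r : ℍ) ∈ T.rhoS) {q0 : ℍ} {p : ℕ → ℍ} (hp : ∀ n, p n ∈ T.rhoS)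
    (hconv : Tendsto p atTop (@nhds ℍ cassiniTopology q0)) :
    q0 ∉ T.rhoS ↔ Tendsto (fun n : ℕ => opNorm (T.qres (p n))) atTop atTop := by
  obtain ⟨r, hr⟩ := hreal
  obtain ⟨R, hR⟩ := exists_resolvent hT hr
  obtain ⟨hre, hnorm⟩ := tendsto_re_and_norm_sq_of_tendsto_cassini hconv
  choose Q hQ using fun n => (isQInv_qres (hp n)).1.exists_continuousLinearMap
  have hQinv (n : ℕ) : T.IsQInv (p n) (Q n) := hQ n ▸ isQInv_qres (hp n)
  simp only [← hQ, opNorm_coe]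
  constructor
  · intro hq0
    refine tendsto_atTop.2 fun M => ?_
    have hlim : Tendsto (fun n => |2 * (q0.re - (p n).re)| *
        (|2 * (p n).re - r| * M + ‖R‖ +
          |r ^ 2 - 2 * (p n).re * r + ‖p n‖ ^ 2| * (‖R‖ * M)) +
          |‖q0‖ ^ 2 - ‖p n‖ ^ 2| * M) atTop (𝓝 (|2 * (q0.re - q0.re)| *
        (|2 * q0.re - r| * M + ‖R‖ +
          |r ^ 2 - 2 * q0.re * r + ‖q0‖ ^ 2| * (‖R‖ * M)) +
          |‖q0‖ ^ 2 - ‖q0‖ ^ 2| * M)) := by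
      refine Tendsto.add (Tendsto.mul ((hre.const_sub _).const_mul 2).abs
        (Tendsto.add (((((hre.const_mul 2).sub_const r).abs).mul_const M).add_const _)
          (Tendsto.mul_const _ ?_))) ((hnorm.const_sub _).abs.mul_const M)
      exact ((((hre.const_mul 2).mul_const r).const_sub _).add hnorm).abs
    simp only [sub_self, mul_zero, abs_zero, zero_mul, add_zero] at hlim
    filter_upwards [hlim.eventually_le_const (show (0 : ℝ) < 1 / 2 by norm_num)] with n hn
    by_contra! hlt
    obtain ⟨Q', hQ', -⟩ := (hQinv n).exists_of_bound_le_half hR hlt.le hn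
    exact hq0 ⟨Q', hQ'⟩
  · rintro htop ⟨B, hB⟩
    obtain ⟨Q₀, rfl⟩ := hB.1.exists_continuousLinearMap
    have hP := hB.toFun_apply_eq hR
    set P := (2 * q0.re - r) • Q₀ + R - (r ^ 2 - 2 * q0.re * r + ‖q0‖ ^ 2) • (R.comp Q₀)
    have hlim : Tendsto
        (fun n => ‖(2 * ((p n).re - q0.re)) • P - (‖p n‖ ^ 2 - ‖q0‖ ^ 2) • Q₀‖) atTop
        (𝓝 ‖(2 * (q0.re - q0.re)) • P - (‖q0‖ ^ 2 - ‖q0‖ ^ 2) • Q₀‖) :=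
      ((((hre.sub_const _).const_mul 2).smul_const P).sub
        ((hnorm.sub_const _).smul_const Q₀)).norm
    simp only [sub_self, mul_zero, zero_smul, norm_zero] at hlim
    obtain ⟨n, hn, hn'⟩ := ((hlim.eventually_le_const
      (show (0 : ℝ) < 1 / 2 by norm_num)).and (htop.eventually_gt_atTop (2 * ‖Q₀‖))).exists
    obtain ⟨Q', hQ', hle⟩ := hB.exists_of_norm_le_half hP hn
    rw [DFunLike.coe_injective ((hQinv n).eq hQ')] at hn'
    exact hn'.not_ge hle

end RightLinearOp

end RealStructure

/-- Corollary `cor2`: if `(p_n)` is a sequence in `ρ_S(A)`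
converging to `q0` in the Cassini topology, then `q0 ∈ σ_S(A)` if and only if
`‖Q_{p_n}(A)‖ → ∞`. -/
theorem stmt7 {X : Type*} [NormedAddCommGroup X] [CompleteSpace X]
    [Module ℍ X] [Module ℍᵐᵒᵖ X] [QuatBimodule X]
    (T : RightLinearOp X) (hT : T.IsClosedOp)
    (hreal : ∃ r : ℝ, ((r : ℝ) : ℍ) ∈ T.rhoS)
    (q0 : ℍ) (p : ℕ → ℍ) (hp : ∀ n, p n ∈ T.rhoS)
    (hconv : Tendsto p atTop (@nhds ℍ cassiniTopology q0)) :
    q0 ∉ T.rhoS ↔ Tendsto (fun n : ℕ => opNorm (T.qres (p n))) atTop atTop := by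
  let _ : NormedSpace ℝ X := QuatBimodule.realNormedSpace X
  have : IsScalarTower ℝ ℍ X := ⟨fun r q x => by
    rw [← Quaternion.coe_mul_eq_smul, mul_smul]
    rfl⟩
  have : IsScalarTower ℝ ℍᵐᵒᵖ X := ⟨fun r q x => by
    obtain ⟨q, rfl⟩ := op_surjective q
    rw [← op_smul, ← Quaternion.mul_coe_eq_smul, op_mul, mul_smul]
    exact (QuatBimodule.real_smul_comm r _).symm⟩
  exact T.notMem_rhoS_iff_tendsto_opNorm_qres hT hreal hp hconv
end

section
/- Let X be a Banach two-sided ℍ-module, let D(A) be a right ℍ-submodule of X, and let A : D(A) → X be a closed right linear operator. Then for all p, q ∈ ρ_S(A): (p̄ − q̄)Id + (Δ_q(A) − Δ_p(A)) S_p⁻¹(A) = (q − p)Id + S_p⁻¹(A) Δ_q(p), where Δ_q(p) = p² − 2Re(q)p + |q|². -/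
open MulOpposite Filter Topology Classical

lemma QuatBimodule.map_coe_smul {X : Type*} [NormedAddCommGroup X]
    [Module ℍ X] [Module ℍᵐᵒᵖ X] [QuatBimodule X] {B : X → X} (hB : MemLinR B) (r : ℝ) (x : X) :
    B ((r : ℍ) • x) = (r : ℍ) • B x := by
  rw [QuatBimodule.real_smul_comm, hB.2.1, QuatBimodule.real_smul_comm]

namespace RightLinearOp

variable {X : Type*} [NormedAddCommGroup X] [Module ℍ X] [Module ℍᵐᵒᵖ X] {T : RightLinearOp X}

lemma coe_smul_mem [QuatBimodule X] (r : ℝ) {x : X} (hx : x ∈ T.dom) : (r : ℍ) • x ∈ T.dom := by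
  rw [QuatBimodule.real_smul_comm]
  exact T.smulR_mem _ hx

lemma map_coe_smul [QuatBimodule X] (r : ℝ) {x : X} (hx : x ∈ T.dom) :
    T.toFun ((r : ℍ) • x) = (r : ℍ) • T.toFun x := by
  rw [QuatBimodule.real_smul_comm, T.map_smulR' _ hx, QuatBimodule.real_smul_comm]

lemma map_sub [QuatBimodule X] {x y : X} (hx : x ∈ T.dom) (hy : y ∈ T.dom) :
    T.toFun (x - y) = T.toFun x - T.toFun y := by
  have h := T.map_add' hx (coe_smul_mem (-1) hy)
  rw [map_coe_smul _ hy] at h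
  simpa [sub_eq_add_neg] using h

end RightLinearOp

lemma deltaPoly_eq (q p : ℍ) :
    deltaPoly q p =
      ((2 * (p.re - q.re) : ℝ) : ℍ) * (((2 * p.re : ℝ) : ℍ) - star p) +
        ((‖q‖ ^ 2 - ‖p‖ ^ 2 : ℝ) : ℍ) := by
  simp only [deltaPoly, sq, ← Quaternion.normSq_eq_norm_mul_self, Quaternion.normSq_def']
  ext <;> simp <;> ring

lemma star_mul_deltaPoly (q p : ℍ) :
    star p * deltaPoly q p =
      ((2 * (p.re - q.re) * ‖p‖ ^ 2 : ℝ) : ℍ) +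
        ((‖q‖ ^ 2 - ‖p‖ ^ 2 : ℝ) : ℍ) * star p := by
  simp only [deltaPoly, sq, ← Quaternion.normSq_eq_norm_mul_self, Quaternion.normSq_def']
  ext <;> simp <;> ring

/-- Lemma `L:(Dq - Dp)Cp=`: for all `p, q ∈ ρ_S(A)`,
`(p̄ − q̄) Id + (Δ_q(A) − Δ_p(A)) S_p⁻¹(A) = (q − p) Id + S_p⁻¹(A) Δ_q(p)`,
where `Δ_q(A) − Δ_p(A) = 2 Re(p − q) A + (|q|² − |p|²) Id` and
`Δ_q(p) = p² − 2 Re(q) p + |q|²`. -/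
theorem stmt10 {X : Type*} [NormedAddCommGroup X] [CompleteSpace X]
    [Module ℍ X] [Module ℍᵐᵒᵖ X] [QuatBimodule X]
    (T : RightLinearOp X) (hT : T.IsClosedOp) :
    ∀ p ∈ T.rhoS, ∀ q ∈ T.rhoS, ∀ x : X,
      (star p - star q) • x +
          ((2 * (p.re - q.re) : ℝ) : ℍ) • T.toFun (T.sres p x) +
          ((‖q‖ ^ 2 - ‖p‖ ^ 2 : ℝ) : ℍ) • T.sres p x =
        (q - p) • x + T.sres p (deltaPoly q p • x) := by
  intro p hp q _ x
  obtain ⟨hlin, hdom, hright, -⟩ := RightLinearOp.isQInv_qres hp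
  let : Module ℝ X := Module.compHom X (algebraMap ℝ ℍ)
  have coe_smul (r : ℝ) (y : X) : (r : ℍ) • y = r • y := rfl
  set Q := T.qres p with hQ
  have hmap (r : ℝ) (y : X) : Q (r • y) = r • Q y := QuatBimodule.map_coe_smul hlin r y
  have hsub (y z : X) : Q (y - z) = Q y - Q z := by
    have h := hlin.1 (y - z) z
    rw [sub_add_cancel] at h
    rw [h, add_sub_cancel_right]
  have hAsmul (r : ℝ) (y : X) : T.toFun (Q (r • y)) = r • T.toFun (Q y) := by
    rw [hmap]
    exact RightLinearOp.map_coe_smul r (hdom y).1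
  have hA : T.toFun (T.sres p x) = T.toFun (Q (star p • x)) - T.toFun (T.toFun (Q x)) :=
    RightLinearOp.map_sub (hdom _).1 (hdom x).2
  have hAA : T.toFun (T.toFun (Q x)) =
      x + (2 * p.re) • T.toFun (Q x) - (‖p‖ ^ 2) • Q x := by
    have h := hright x
    simp only [RightLinearOp.delta, coe_smul] at h
    nth_rewrite 2 [← h]
    abel
  have hpoly : deltaPoly q p • x = (2 * (p.re - q.re)) • ((2 * p.re) • x - star p • x) +
      (‖q‖ ^ 2 - ‖p‖ ^ 2) • x := by
    rw [deltaPoly_eq, add_smul, mul_smul, sub_smul]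
    rfl
  have hstar : star p • deltaPoly q p • x = (2 * (p.re - q.re) * ‖p‖ ^ 2) • x +
      (‖q‖ ^ 2 - ‖p‖ ^ 2) • star p • x := by
    rw [smul_smul, star_mul_deltaPoly, add_smul, mul_smul]
    rfl
  have hS : T.sres p (deltaPoly q p • x) =
      (2 * (p.re - q.re) * ‖p‖ ^ 2) • Q x + (‖q‖ ^ 2 - ‖p‖ ^ 2) • Q (star p • x) -
        ((2 * (p.re - q.re)) • ((2 * p.re) • T.toFun (Q x) - T.toFun (Q (star p • x))) +
          (‖q‖ ^ 2 - ‖p‖ ^ 2) • T.toFun (Q x)) := by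
    rw [RightLinearOp.sres, ← hQ, hstar, hpoly, hlin.1, hmap, hmap, hlin.1,
      T.map_add' (hdom _).1 (hdom _).1, hAsmul, hAsmul, hsub,
      RightLinearOp.map_sub (hdom _).1 (hdom _).1, hAsmul]
  have hx : (star p - star q) • x = (q - p) • x + (2 * (p.re - q.re)) • x := by
    rw [← coe_smul, ← add_smul]
    congr 1
    ext <;> simp <;> ring
  rw [hS, hA, hAA, hx, RightLinearOp.sres, ← hQ, coe_smul, coe_smul]
  generalize (q - p) • x = w
  module
end

section
/- Let D be a nonempty connected open subset of ℂ, invariant under complex conjugation, with D ∩ ℝ ≠ ∅, and let f : Ω_D → X be a function. Then f is right slice regular if and only if f is right slice hyperholomorphic, i.e. if and only if for every j ∈ S the function f_j : D → X_j, f_j(r+si) := f(r+sj), is holomorphic (of class C¹ in the real sense with ∂f_j/∂r + (∂f_j/∂s)j = 0 on D). -/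
open MulOpposite Filter Topology Classical

noncomputable section

/-- The unit imaginary sphere `S = {j ∈ ℍ : j² = −1}`. -/
def Sph : Set ℍ := {j : ℍ | j * j = -1}

/-- The circularization `Ω_D ⊆ ℍ` of a set `D ⊆ ℂ`. -/
def circ (D : Set ℂ) : Set ℍ :=
  {q : ℍ | ∃ (r s : ℝ) (j : ℍ), j ∈ Sph ∧ (⟨r, s⟩ : ℂ) ∈ D ∧ q = ((r : ℝ) : ℍ) + s • j}

/-- A function `f : Ω_D → X`, `X` a Banach two-sided `ℍ`-module, is
*right slice regular* if it is induced by a stem function `F = (F₁,F₂) : D → X²`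
(`F₁` even, `F₂` odd under complex conjugation) of class `C¹` in the real sense,
i.e. `f(r + s j) = F₁(r + s i) + F₂(r + s i) j` for all `j ∈ S`, satisfying the
Cauchy–Riemann equations `∂F₁/∂r = ∂F₂/∂s`, `∂F₁/∂s = −∂F₂/∂r` on `D`. -/
def RightSliceRegular {X : Type*} [NormedAddCommGroup X] [Module ℍ X]
    [Module ℍᵐᵒᵖ X] [NormedSpace ℝ X] (D : Set ℂ) (f : ℍ → X) : Prop :=
  ∃ F₁ F₂ : ℂ → X,
    (∀ z ∈ D, F₁ ((starRingEnd ℂ) z) = F₁ z) ∧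
    (∀ z ∈ D, F₂ ((starRingEnd ℂ) z) = -F₂ z) ∧
    ContDiffOn ℝ 1 F₁ D ∧ ContDiffOn ℝ 1 F₂ D ∧
    (∀ r s : ℝ, (⟨r, s⟩ : ℂ) ∈ D → ∀ j ∈ Sph,
      f (((r : ℝ) : ℍ) + s • j) = F₁ ⟨r, s⟩ + op j • F₂ ⟨r, s⟩) ∧
    (∀ z ∈ D, fderiv ℝ F₁ z 1 = fderiv ℝ F₂ z Complex.I ∧
      fderiv ℝ F₁ z Complex.I = -fderiv ℝ F₂ z 1)

/-- The spherical derivative of an `X`-valued function on `ℍ`: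
`∂_S f(q) = (f(q) − f(q̄))(q − q̄)⁻¹` off the real axis, and the derivative of `f`
along the real axis at real points. -/
def sderivX {X : Type*} [NormedAddCommGroup X] [Module ℍ X] [Module ℍᵐᵒᵖ X]
    [NormedSpace ℝ X] (f : ℍ → X) (q : ℍ) : X :=
  if q.im = 0 then deriv (fun t : ℝ => f ((t : ℝ) : ℍ)) q.re
  else op ((q - star q)⁻¹) • (f q - f (star q))

/-- `g : Ω → Z`, with `Ω ⊆ ℍ ≅ ℝ⁴` and `Z` a real Banach space, is real
analytic: around every point of `Ω` it is the sum, in the sense of summability,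
of a power series in the four real coordinates with coefficients in `Z`. -/
def RealAnalyticOnH {Z : Type*} [NormedAddCommGroup Z] [NormedSpace ℝ Z]
    (g : ℍ → Z) (Ω : Set ℍ) : Prop :=
  ∀ q0 ∈ Ω, ∃ ε : ℝ, 0 < ε ∧ Metric.ball q0 ε ⊆ Ω ∧
    ∃ c : (Fin 4 → ℕ) → Z, ∀ q ∈ Metric.ball q0 ε,
      HasSum (fun h : Fin 4 → ℕ =>
        (((q.re - q0.re) ^ h 0 * (q.imI - q0.imI) ^ h 1 *
          (q.imJ - q0.imJ) ^ h 2 * (q.imK - q0.imK) ^ h 3 : ℝ)) • c h) (g q)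

end

/-- Identity theorem: a function satisfying the Cauchy–Riemann equation for a complex
structure `J` on a connected open set vanishes if it vanishes on the real points of that set,
provided there is one. -/
theorem eqOn_zero_of_cauchyRiemann {E : Type*} [NormedAddCommGroup E] [CompleteSpace E]
    [NormedSpace ℝ E] (J : E →L[ℝ] E) (hJ : ∀ x, J (J x) = -x)
    (hnorm : ∀ (z : ℂ) (x : E), ‖z.re • x + z.im • J x‖ ≤ ‖z‖ * ‖x‖)
    {D : Set ℂ} (hopen : IsOpen D) (hconn : IsPreconnected D) {a : ℝ} (ha : (a : ℂ) ∈ D)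
    {g : ℂ → E} (hg : DifferentiableOn ℝ g D)
    (hCR : ∀ z ∈ D, fderiv ℝ g z 1 + J (fderiv ℝ g z Complex.I) = 0)
    (hzero : ∀ r : ℝ, (r : ℂ) ∈ D → g r = 0) : Set.EqOn g 0 D := by
  let _ : Module ℂ E :=
    Module.compHom E (Complex.liftAux (A := Module.End ℝ E) (J : E →ₗ[ℝ] E)
      (by ext x; simp [hJ])).toRingHom
  have smul_def : ∀ (z : ℂ) (x : E), z • x = z.re • x + z.im • J x := fun z x => rfl
  let _ : NormedSpace ℂ E := { norm_smul_le := fun z x => by rw [smul_def]; exact hnorm z x }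
  have : IsScalarTower ℝ ℂ E := ⟨fun r z x => by
    simp only [smul_def, Complex.smul_re, Complex.smul_im, smul_add, smul_assoc]⟩
  have hdiff : DifferentiableOn ℂ g D := fun z hz => by
    have hgz := hg.differentiableAt (hopen.mem_nhds hz)
    refine ((differentiableAt_iff_restrictScalars ℝ hgz).2
      ⟨ContinuousLinearMap.toSpanSingleton ℂ (fderiv ℝ g z 1), ?_⟩).differentiableWithinAt
    have hI : fderiv ℝ g z Complex.I = J (fderiv ℝ g z 1) := by
      rw [eq_neg_of_add_eq_zero_left (hCR z hz), map_neg, hJ, neg_neg]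
    ext w
    have hw : w = w.re • (1 : ℂ) + w.im • Complex.I := by simp
    conv_rhs => rw [hw, map_add, map_smul, map_smul, hI]
    rfl
  refine (hdiff.analyticOnNhd hopen).eqOn_zero_of_preconnected_of_frequently_eq_zero hconn ha ?_
  have htend : Tendsto (fun r : ℝ => (r : ℂ)) (𝓝[≠] a) (𝓝[≠] (a : ℂ)) :=
    Complex.continuous_ofReal.continuousAt.continuousWithinAt.tendsto_nhdsWithin
      fun r hr => by simpa using hr
  have hmem : ∀ᶠ r : ℝ in 𝓝[≠] a, (r : ℂ) ∈ D :=
    (htend.mono_right nhdsWithin_le_nhds).eventually (hopen.mem_nhds ha)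
  exact htend.frequently (hmem.mono hzero).frequently

theorem Sph.nonempty : Sph.Nonempty := by
  obtain ⟨i, h0, h1, h2, h3⟩ : ∃ i : ℍ, i.re = 0 ∧ i.imI = 1 ∧ i.imJ = 0 ∧ i.imK = 0 :=
    ⟨⟨0, 1, 0, 0⟩, rfl, rfl, rfl, rfl⟩
  refine ⟨i, ?_⟩
  change i * i = -1
  apply Quaternion.ext <;> simp [h0, h1, h2, h3, Quaternion.re_one, Quaternion.imI_one,
    Quaternion.imJ_one, Quaternion.imK_one]

theorem Sph.re_eq_zero {j : ℍ} (hj : j ∈ Sph) : j.re = 0 := by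
  have hj' : j * j = -1 := hj
  have h := congrArg (fun q : ℍ => (q.re, q.imI, q.imJ, q.imK)) hj'
  simp only [Quaternion.re_mul, Quaternion.imI_mul, Quaternion.imJ_mul, Quaternion.imK_mul,
    Quaternion.re_neg, Quaternion.imI_neg, Quaternion.imJ_neg, Quaternion.imK_neg,
    Quaternion.re_one, Quaternion.imI_one, Quaternion.imJ_one, Quaternion.imK_one,
    Prod.mk.injEq] at h
  obtain ⟨h0, h1, h2, h3⟩ := h
  by_contra hre
  have hi : j.imI = 0 := by apply mul_left_cancel₀ hre; linarith
  have hj : j.imJ = 0 := by apply mul_left_cancel₀ hre; linarith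
  have hk : j.imK = 0 := by apply mul_left_cancel₀ hre; linarith
  rw [hi, hj, hk] at h0
  nlinarith [mul_self_nonneg j.re]

theorem Sph.norm_re_add_im_smul {j : ℍ} (hj : j ∈ Sph) (z : ℂ) :
    ‖((z.re : ℝ) : ℍ) + z.im • j‖ = ‖z‖ := by
  have h0 := Sph.re_eq_zero hj
  have hj' : j * j = -1 := hj
  have h := congrArg (fun q : ℍ => q.re) hj'
  simp only [Quaternion.re_mul, Quaternion.re_neg, Quaternion.re_one, h0] at h
  rw [← sq_eq_sq₀ (norm_nonneg _) (norm_nonneg _), sq, ← Quaternion.normSq_eq_norm_mul_self,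
    Complex.sq_norm, Quaternion.normSq_def', Complex.normSq_apply]
  simp [h0]
  linear_combination (-z.im ^ 2) * h

theorem Sph.op_smul_op_smul {X : Type*} [NormedAddCommGroup X] [Module ℍᵐᵒᵖ X] {j : ℍ}
    (hj : j ∈ Sph) (x : X) : op j • op j • x = -x := by
  have hj' : j * j = -1 := hj
  rw [← mul_smul, ← op_mul, hj', op_neg, op_one, neg_one_smul]

/-- Right multiplication by a quaternion, as a continuous real linear map. -/
noncomputable def rightSMulCLM {X : Type*} [NormedAddCommGroup X] [Module ℍ X] [Module ℍᵐᵒᵖ X]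
    [QuatBimodule X] [NormedSpace ℝ X]
    (hcompat : ∀ (r : ℝ) (x : X), r • x = ((r : ℝ) : ℍ) • x) (q : ℍ) : X →L[ℝ] X :=
  LinearMap.mkContinuous
    { toFun := fun x => op q • x
      map_add' := fun x y => smul_add _ x y
      map_smul' := fun r x => by
        simp only [hcompat, RingHom.id_apply, QuatBimodule.smul_op_comm] }
    ‖q‖ fun x => (QuatBimodule.norm_smul_right q x).le

theorem norm_re_smul_add_im_smul_le {X : Type*} [NormedAddCommGroup X] [Module ℍ X]
    [Module ℍᵐᵒᵖ X] [QuatBimodule X] [NormedSpace ℝ X]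
    (hcompat : ∀ (r : ℝ) (x : X), r • x = ((r : ℝ) : ℍ) • x) {j : ℍ} (hj : j ∈ Sph)
    (z : ℂ) (x : X) : ‖z.re • x + z.im • op j • x‖ ≤ ‖z‖ * ‖x‖ := by
  have h : z.re • x + z.im • op j • x = op (((z.re : ℝ) : ℍ) + z.im • j) • x := by
    rw [hcompat, hcompat, QuatBimodule.real_smul_comm, QuatBimodule.smul_op_comm,
      QuatBimodule.real_smul_comm, op_add, add_smul, ← mul_smul, ← op_mul,
      Quaternion.coe_mul_eq_smul]
  rw [h, QuatBimodule.norm_smul_right, Sph.norm_re_add_im_smul hj]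

/-- The combination `F₁ + F₂ j` satisfies the Cauchy–Riemann equation for right multiplication
by `j` if `(F₁, F₂)` satisfies the Cauchy–Riemann equations. -/
theorem fderiv_stem_cauchyRiemann {X : Type*} [NormedAddCommGroup X] [NormedSpace ℝ X]
    (J : X →L[ℝ] X) (hJ : ∀ x, J (J x) = -x) {F₁ F₂ : ℂ → X} {z : ℂ}
    (h₁ : DifferentiableAt ℝ F₁ z) (h₂ : DifferentiableAt ℝ F₂ z)
    (hr : fderiv ℝ F₁ z 1 = fderiv ℝ F₂ z Complex.I)
    (hs : fderiv ℝ F₁ z Complex.I = -fderiv ℝ F₂ z 1) :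
    fderiv ℝ (fun w => F₁ w + J (F₂ w)) z 1 +
      J (fderiv ℝ (fun w => F₁ w + J (F₂ w)) z Complex.I) = 0 := by
  have h := h₁.hasFDerivAt.add (J.hasFDerivAt.comp z h₂.hasFDerivAt)
  have h' : fderiv ℝ (fun w => F₁ w + J (F₂ w)) z =
      fderiv ℝ F₁ z + J.comp (fderiv ℝ F₂ z) := h.fderiv
  simp only [h', add_apply, ContinuousLinearMap.comp_apply, map_add, hJ,
    hr, hs, map_neg]
  abel

/-- A `J`-holomorphic function on a conjugation-invariant set splits into an even and an odd part
which form a holomorphic stem function. -/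
theorem exists_stem_of_cauchyRiemann {X : Type*} [NormedAddCommGroup X] [NormedSpace ℝ X]
    (J : X →L[ℝ] X) (hJ : ∀ x, J (J x) = -x) {D : Set ℂ} (hopen : IsOpen D)
    (hconj : ∀ z ∈ D, (starRingEnd ℂ) z ∈ D) {g : ℂ → X} (hg : ContDiffOn ℝ 1 g D)
    (hCR : ∀ z ∈ D, fderiv ℝ g z 1 + J (fderiv ℝ g z Complex.I) = 0) :
    ∃ F₁ F₂ : ℂ → X,
      (∀ z, F₁ ((starRingEnd ℂ) z) = F₁ z) ∧ (∀ z, F₂ ((starRingEnd ℂ) z) = -F₂ z) ∧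
      ContDiffOn ℝ 1 F₁ D ∧ ContDiffOn ℝ 1 F₂ D ∧
      (∀ r : ℝ, F₁ r = g r) ∧
      (∀ z ∈ D, fderiv ℝ F₁ z 1 = fderiv ℝ F₂ z Complex.I ∧
        fderiv ℝ F₁ z Complex.I = -fderiv ℝ F₂ z 1) := by
  have hgc : ContDiffOn ℝ 1 (fun z => g ((starRingEnd ℂ) z)) D :=
    hg.comp (Complex.conjCLE.contDiff (n := 1)).contDiffOn hconj
  refine ⟨fun z => (1 / 2 : ℝ) • (g z + g ((starRingEnd ℂ) z)),
    fun z => (1 / 2 : ℝ) • J (g ((starRingEnd ℂ) z) - g z), fun z => ?_, fun z => ?_,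
    (hg.add hgc).const_smul _, (J.contDiff.comp_contDiffOn (hgc.sub hg)).const_smul _,
    fun r => ?_, fun z hz => ?_⟩
  · simp [add_comm]
  · simp only [Complex.conj_conj]
    rw [← smul_neg, ← map_neg, neg_sub]
  · simp only [Complex.conj_ofReal]
    rw [← two_smul ℝ (g r), smul_smul]
    norm_num
  · have hz' := hconj z hz
    have hd := ((hg.differentiableOn one_ne_zero).differentiableAt (hopen.mem_nhds hz)).hasFDerivAt
    have hd' := ((hg.differentiableOn one_ne_zero).differentiableAt
      (hopen.mem_nhds hz')).hasFDerivAt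
    have hdc : HasFDerivAt (fun z => g ((starRingEnd ℂ) z)) _ z :=
      hd'.comp z (Complex.conjCLE : ℂ →L[ℝ] ℂ).hasFDerivAt
    have e₁ := ((hd.add hdc).const_smul (1 / 2 : ℝ)).fderiv
    have e₂ := ((J.hasFDerivAt.comp z (hdc.sub hd)).const_smul (1 / 2 : ℝ)).fderiv
    have c := eq_neg_of_add_eq_zero_left (hCR z hz)
    have c' := eq_neg_of_add_eq_zero_left (hCR _ hz')
    change fderiv ℝ (fun z => (1 / 2 : ℝ) • (g z + g ((starRingEnd ℂ) z))) z = _ at e₁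
    change fderiv ℝ (fun z => (1 / 2 : ℝ) • J (g ((starRingEnd ℂ) z) - g z)) z = _ at e₂
    rw [e₁, e₂]
    simp [c, c', hJ]
    constructor <;> module

/-- Lemma `equivalence`: if `D ⊆ ℂ` is nonempty, connected,
open, invariant under complex conjugation, and `D ∩ ℝ ≠ ∅`, then `f : Ω_D → X`
is right slice regular if and only if it is right slice hyperholomorphic, i.e.
for every `j ∈ S` the function `f_j(z) = f(Re z + (Im z) j)` is of class `C¹`
(in the real sense) on `D` and satisfies `∂f_j/∂r + (∂f_j/∂s) j = 0` on `D`
(holomorphy of `f_j : D → X_j`). -/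
theorem stmt12 {X : Type*} [NormedAddCommGroup X] [CompleteSpace X]
    [Module ℍ X] [Module ℍᵐᵒᵖ X] [QuatBimodule X] [NormedSpace ℝ X]
    (hcompat : ∀ (r : ℝ) (x : X), r • x = ((r : ℝ) : ℍ) • x)
    (D : Set ℂ) (hopen : IsOpen D) (hconn : IsConnected D)
    (hconj : ∀ z ∈ D, (starRingEnd ℂ) z ∈ D)
    (hR : ∃ r : ℝ, (r : ℂ) ∈ D)
    (f : ℍ → X) :
    RightSliceRegular D f ↔
      ∀ j ∈ Sph,
        ContDiffOn ℝ 1 (fun z : ℂ => f (((z.re : ℝ) : ℍ) + z.im • j)) D ∧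
        ∀ z ∈ D,
          fderiv ℝ (fun w : ℂ => f (((w.re : ℝ) : ℍ) + w.im • j)) z 1 +
            op j • fderiv ℝ (fun w : ℂ => f (((w.re : ℝ) : ℍ) + w.im • j)) z Complex.I
            = 0 := by
  set J : ℍ → X →L[ℝ] X := rightSMulCLM hcompat
  have hJ : ∀ j ∈ Sph, ∀ x, J j (J j x) = -x := fun j hj x => Sph.op_smul_op_smul hj x
  constructor
  · rintro ⟨F₁, F₂, -, -, h₁, h₂, hf, hCR⟩ j hj
    have heq : Set.EqOn (fun z : ℂ => f (((z.re : ℝ) : ℍ) + z.im • j))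
        (fun z => F₁ z + J j (F₂ z)) D := fun z hz => hf z.re z.im hz j hj
    refine ⟨(h₁.add ((J j).contDiff.comp_contDiffOn h₂)).congr heq, fun z hz => ?_⟩
    rw [(heq.eventuallyEq_of_mem (hopen.mem_nhds hz)).fderiv_eq]
    exact fderiv_stem_cauchyRiemann (J j) (hJ j hj)
      ((h₁.differentiableOn one_ne_zero).differentiableAt (hopen.mem_nhds hz))
      ((h₂.differentiableOn one_ne_zero).differentiableAt (hopen.mem_nhds hz))
      (hCR z hz).1 (hCR z hz).2
  · intro h
    obtain ⟨i, hi⟩ := Sph.nonempty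
    obtain ⟨F₁, F₂, heven, hodd, h₁, h₂, hreal, hCR⟩ :=
      exists_stem_of_cauchyRiemann (J i) (hJ i hi) hopen hconj (h i hi).1 (h i hi).2
    refine ⟨F₁, F₂, fun z _ => heven z, fun z _ => hodd z, h₁, h₂, fun r s hrs j hj => ?_, hCR⟩
    obtain ⟨a, ha⟩ := hR
    obtain ⟨hj₁, hj₂⟩ := h j hj
    have hF := h₁.add ((J j).contDiff.comp_contDiffOn h₂)
    have hzero := eqOn_zero_of_cauchyRiemann (J j) (hJ j hj)
      (norm_re_smul_add_im_smul_le hcompat hj) hopen hconn.isPreconnected ha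
      (g := fun z : ℂ => f (((z.re : ℝ) : ℍ) + z.im • j) - (F₁ z + J j (F₂ z)))
      ((hj₁.sub hF).differentiableOn one_ne_zero) (fun z hz => ?_) (fun r _ => ?_)
    · exact sub_eq_zero.1 (hzero hrs)
    · have hd := (hj₁.differentiableOn one_ne_zero).differentiableAt (hopen.mem_nhds hz)
      have hd' := (hF.differentiableOn one_ne_zero).differentiableAt (hopen.mem_nhds hz)
      have e := (hd.hasFDerivAt.sub hd'.hasFDerivAt).fderiv
      have hstem := fderiv_stem_cauchyRiemann (J j) (hJ j hj)
        ((h₁.differentiableOn one_ne_zero).differentiableAt (hopen.mem_nhds hz))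
        ((h₂.differentiableOn one_ne_zero).differentiableAt (hopen.mem_nhds hz))
        (hCR z hz).1 (hCR z hz).2
      refine (congrArg (fun L : ℂ →L[ℝ] X => L 1 + J j (L Complex.I)) e).trans ?_
      have hslice := hj₂ z hz
      simp only [sub_apply, map_sub, sub_add_sub_comm]
      exact sub_eq_zero.2 (hslice.trans hstem.symm)
    · have hF₂ : F₂ r = 0 := by
        have := hodd r
        rw [Complex.conj_ofReal, eq_neg_iff_add_eq_zero, ← two_smul ℝ] at this
        simpa using this
      simp [hreal, hF₂]
end
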